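/- For distinct real numbers r₁,...,r_{α+1} and any family of monic polynomials P_k of degree k orthogonal with respect to the weight x² e^{-x} on [0,∞), the multiple integral ∫_{[0,∞)^n} ∏_{j=1}^n x_j² e^{-x_j} ∏_{i=1}^{α+1}(r_i - x_j) · Δ_n²(x) dx equals ∏_{i=0}^{n-1}(i+1)!(i+2)! · det[P_{n+i-1}(r_j)]_{i,j=1..α+1} / Δ_{α+1}(r). -/

import Mathlib

open MeasureTheory Finset

open Polynomial in
theorem integrable_gammaWeight_mul_eval (p : ℝ[X]) :
    Integrable (fun x => x ^ 2 * Real.exp (-x) * p.eval x) (volume.restrict (Set.Ioi 0)) := by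
  induction p using Polynomial.induction_on' with
  | add p q hp hq =>
    simp only [eval_add, mul_add]
    exact hp.add hq
  | monomial k a =>
    have h := (Real.GammaIntegral_convergent (s := (k + 2 : ℕ) + 1) (by positivity)).const_mul a
    refine Integrable.congr h (Filter.Eventually.of_forall fun x => ?_)
    simp only [add_sub_cancel_right, Real.rpow_natCast, eval_monomial]
    ring

open Polynomial in
/-- Integration of polynomials against the weight `x² e^{-x}` on `(0, ∞)`. -/
noncomputable def gammaMoment : ℝ[X] →ₗ[ℝ] ℝ where
  toFun p := ∫ x in Set.Ioi (0 : ℝ), x ^ 2 * Real.exp (-x) * p.eval x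
  map_add' p q := by
    simp only [eval_add, mul_add]
    exact integral_add (integrable_gammaWeight_mul_eval p) (integrable_gammaWeight_mul_eval q)
  map_smul' a p := by
    rw [RingHom.id_apply, smul_eq_mul, ← integral_const_mul]
    simp only [eval_smul, smul_eq_mul]
    congr 1 with x
    ring

open Polynomial in
theorem gammaMoment_apply (p : ℝ[X]) :
    gammaMoment p = ∫ x in Set.Ioi (0 : ℝ), x ^ 2 * Real.exp (-x) * p.eval x := rfl

open Polynomial in
theorem gammaMoment_X_pow (k : ℕ) : gammaMoment (X ^ k) = (k + 2).factorial := by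
  rw [← Real.Gamma_nat_eq_factorial, Real.Gamma_eq_integral (by positivity), gammaMoment_apply]
  refine integral_congr_ae (Filter.Eventually.of_forall fun x => ?_)
  simp only [add_sub_cancel_right, Real.rpow_natCast, eval_pow, eval_X]
  ring

open Polynomial in
/-- A member of a monic family orthogonal for a linear functional is orthogonal to every
polynomial of lower degree. -/
theorem map_mul_eq_zero_of_degree_lt {R : Type*} [CommRing R] [Nontrivial R] (L : R[X] →ₗ[R] R)
    {P : ℕ → R[X]} (hmonic : ∀ k, (P k).Monic) (hdeg : ∀ k, (P k).natDegree = k)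
    (horth : ∀ j k, j ≠ k → L (P j * P k) = 0) (k : ℕ) :
    ∀ d ≤ k, ∀ p : R[X], p.degree < d → L (p * P k) = 0 := by
  intro d
  induction d with
  | zero =>
    intro _ p hp
    rw [degree_eq_bot.mp (Nat.WithBot.lt_zero_iff.mp hp), zero_mul, map_zero]
  | succ d ih =>
    intro hd p hp
    have hlow : (p - p.coeff d • P d).degree < d := by
      rw [degree_lt_iff_coeff_zero] at hp ⊢
      intro m hm
      rcases hm.eq_or_lt with rfl | hm
      · have h := (hmonic d).coeff_natDegree
        rw [hdeg] at h
        simp [h]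
      · have h : (P d).coeff m = 0 := coeff_eq_zero_of_natDegree_lt (by rwa [hdeg])
        simp [h, hp m hm]
    have h := ih (by omega) _ hlow
    rwa [sub_mul, smul_mul_assoc, map_sub, map_smul, horth d k (by omega), smul_zero,
      sub_zero] at h

open Matrix in
/-- The Hankel determinant of the moments `(i + j + 2)!`. -/
theorem det_factorial_add_two (n : ℕ) :
    (of fun i j : Fin n => (((i + j + 2 : ℕ).factorial : ℕ) : ℝ)).det =
      ∏ i ∈ range n, (i.factorial : ℝ) * (i + 2).factorial := by
  have hentry : (of fun i j : Fin n => (((i + j + 2 : ℕ).factorial : ℕ) : ℝ)) =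
      of fun i j : Fin n => (((i + 2 : ℕ).factorial : ℕ) : ℝ) *
        (of fun i j : Fin n => (ascPochhammer ℝ j).eval ((i : ℝ) + 3)) i j := by
    ext i j
    have h := ascPochhammer_nat_eq_natCast_ascFactorial ℝ (i + 3) j
    push_cast at h
    simp only [of_apply]
    rw [h]
    norm_cast
    rw [Nat.factorial_mul_ascFactorial]
    congr 1
    ring
  have hvand : (vandermonde fun i : Fin n => (i : ℝ)).det = ∏ i ∈ range n, (i.factorial : ℝ) := by
    cases n with
    | zero => simp
    | succ n =>
      rw [det_vandermonde_id_eq_superFactorial, ← Nat.prod_range_succ_factorial, Nat.cast_prod]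
  rw [hentry, det_mul_column, ← det_eval_matrixOfPolynomials_eq_det_vandermonde
    (fun i : Fin n => (i : ℝ) + 3) (fun j => ascPochhammer ℝ j)
    (fun j => ascPochhammer_natDegree _ _) (fun j => monic_ascPochhammer _ _),
    det_vandermonde_add, hvand, prod_mul_distrib,
    ← Fin.prod_univ_eq_prod_range (fun i => (((i + 2).factorial : ℕ) : ℝ)), mul_comm]

open Matrix Polynomial in
/-- The Gram determinant of the monomials against a monic family equals the Hankel
determinant of the moments. -/
theorem det_map_X_pow_mul {R : Type*} [CommRing R] (L : R[X] →ₗ[R] R) {n : ℕ} (p : Fin n → R[X])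
    (hdeg : ∀ i, (p i).natDegree = i) (hmonic : ∀ i, (p i).Monic) :
    (of fun i j : Fin n => L (X ^ (i : ℕ) * p j)).det =
      (of fun i j : Fin n => L (X ^ (i + j : ℕ))).det := by
  have h : (of fun i j : Fin n => L (X ^ (i : ℕ) * p j)) =
      (of fun i j : Fin n => L (X ^ (i + j : ℕ))) * of fun i j : Fin n => (p j).coeff i := by
    ext i j
    rw [mul_apply, of_apply]
    conv_lhs => rw [(p j).as_sum_range' n (by rw [hdeg]; exact j.2), mul_sum, map_sum,
      ← Fin.sum_univ_eq_sum_range (fun l => L (X ^ (i : ℕ) * monomial l ((p j).coeff l)))]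
    refine sum_congr rfl fun l _ => ?_
    rw [← C_mul_X_pow_eq_monomial, mul_left_comm, ← pow_add, ← smul_eq_C_mul, map_smul,
      smul_eq_mul, mul_comm]
    rfl
  rw [h, det_mul, det_matrixOfPolynomials p hdeg hmonic, mul_one]

open Matrix in
/-- If the `j`-th row of a matrix depends on the `j`-th variable only, the determinant can be
integrated row by row. -/
theorem integral_det_sum_elim {ι κ E : Type*} [Fintype ι] [Fintype κ] [DecidableEq ι]
    [DecidableEq κ] [MeasurableSpace E] (μ : Measure E) [SigmaFinite μ]
    (A : ι → E → ι ⊕ κ → ℝ) (B : κ → ι ⊕ κ → ℝ) (hA : ∀ j c, Integrable (fun t => A j t c) μ) :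
    Integrable (fun x : ι → E => (of (Sum.elim (fun j => A j (x j)) B)).det)
        (Measure.pi fun _ => μ) ∧
      ∫ x : ι → E, (of (Sum.elim (fun j => A j (x j)) B)).det ∂(Measure.pi fun _ => μ) =
        (of (Sum.elim (fun j c => ∫ t, A j t c ∂μ) B)).det := by
  have hint : ∀ τ : Equiv.Perm (ι ⊕ κ), Integrable (fun x : ι → E =>
      ((τ.sign : ℤ) : ℝ) * ((∏ j, A j (x j) (τ (.inl j))) * ∏ i, B i (τ (.inr i))))
      (Measure.pi fun _ => μ) := fun τ =>
    ((Integrable.fintype_prod fun j => hA j (τ (.inl j))).mul_const _).const_mul _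
  simp_rw [← det_transpose (of (Sum.elim _ B)), det_apply', Fintype.prod_sum_type,
    transpose_apply, of_apply, Sum.elim_inl, Sum.elim_inr]
  refine ⟨integrable_finsetSum _ fun τ _ => hint τ, ?_⟩
  rw [integral_finsetSum _ fun τ _ => hint τ]
  refine sum_congr rfl fun τ _ => ?_
  rw [integral_const_mul, integral_mul_const,
    integral_fintype_prod_eq_prod (fun j t => A j t (τ (.inl j)))]

theorem prod_filter_lt_eq_det_vandermonde {R : Type*} [CommRing R] {n : ℕ} (v : Fin n → R) :
    ∏ p ∈ univ.filter (fun p : Fin n × Fin n => p.1 < p.2), (v p.2 - v p.1) =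
      (Matrix.vandermonde v).det := by
  rw [Matrix.det_vandermonde, prod_filter, Fintype.prod_prod_type]
  refine prod_congr rfl fun i _ => ?_
  rw [← prod_filter]
  congr 1
  ext j
  simp

theorem det_vandermonde_append {R : Type*} [CommRing R] {n m : ℕ} (x : Fin n → R)
    (r : Fin m → R) :
    (Matrix.vandermonde (Fin.append x r)).det =
      (Matrix.vandermonde x).det * (Matrix.vandermonde r).det * ∏ j, ∏ i, (r i - x j) := by
  simp only [← prod_filter_lt_eq_det_vandermonde, prod_filter, Fintype.prod_prod_type,
    Fin.prod_univ_add, Fin.append_left, Fin.append_right]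
  have h₁ : ∀ (i : Fin m) (j : Fin n), ¬ Fin.natAdd n i < Fin.castAdd m j := by
    intro i j; simp only [Fin.lt_def, Fin.val_natAdd, Fin.val_castAdd]; omega
  have h₂ : ∀ (j : Fin n) (i : Fin m), Fin.castAdd m j < Fin.natAdd n i := by
    intro j i; simp only [Fin.lt_def, Fin.val_natAdd, Fin.val_castAdd]; omega
  simp only [h₁, h₂, if_true, if_false, prod_const_one, one_mul, prod_mul_distrib,
    Fin.lt_def, Fin.val_natAdd, Fin.val_castAdd, add_lt_add_iff_left]
  ring

open Matrix Polynomial in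
/-- The evaluation matrix of a monic family at two groups of points, in block form. -/
theorem det_sum_elim_eval {R : Type*} [CommRing R] {n m : ℕ} {P : ℕ → R[X]}
    (hmonic : ∀ k, (P k).Monic) (hdeg : ∀ k, (P k).natDegree = k)
    (x : Fin n → R) (r : Fin m → R) :
    (of (Sum.elim (fun j c => (P (finSumFinEquiv c)).eval (x j))
        fun i c => (P (finSumFinEquiv c)).eval (r i)) :
      Matrix (Fin n ⊕ Fin m) (Fin n ⊕ Fin m) R).det =
      (vandermonde x).det * (vandermonde r).det * ∏ j, ∏ i, (r i - x j) := by
  rw [← det_vandermonde_append, det_eval_matrixOfPolynomials_eq_det_vandermonde _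
    (fun i => P i) (fun i => hdeg i) (fun i => hmonic i),
    ← det_submatrix_equiv_self finSumFinEquiv]
  congr 1
  ext (a | a) c <;> simp

open Matrix Polynomial in
/-- The block determinant after integration: the orthogonality kills the upper right block. -/
theorem det_sum_elim_map {R : Type*} [CommRing R] [Nontrivial R] (L : R[X] →ₗ[R] R) {n m : ℕ}
    {P : ℕ → R[X]} (hmonic : ∀ k, (P k).Monic) (hdeg : ∀ k, (P k).natDegree = k)
    (horth : ∀ j k, j ≠ k → L (P j * P k) = 0) (r : Fin m → R) (σ : Equiv.Perm (Fin n)) :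
    (of (Sum.elim (fun j c => L (X ^ (σ j : ℕ) * P (finSumFinEquiv c)))
        fun i c => (P (finSumFinEquiv c)).eval (r i)) :
      Matrix (Fin n ⊕ Fin m) (Fin n ⊕ Fin m) R).det =
      ((σ.sign : ℤ) : R) * (of fun i j : Fin n => L (X ^ (i + j : ℕ))).det *
        (of fun i j : Fin m => (P (n + i)).eval (r j)).det := by
  have hblocks : (of (Sum.elim (fun j c => L (X ^ (σ j : ℕ) * P (finSumFinEquiv c)))
        fun i c => (P (finSumFinEquiv c)).eval (r i)) :
      Matrix (Fin n ⊕ Fin m) (Fin n ⊕ Fin m) R) =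
      fromBlocks ((of fun i j : Fin n => L (X ^ (i : ℕ) * P j)).submatrix σ id) 0
        (of fun i j => (P j).eval (r i)) (of fun i j : Fin m => (P (n + i)).eval (r j))ᵀ := by
    ext (a | a) (c | c)
    · simp
    · have h := map_mul_eq_zero_of_degree_lt L hmonic hdeg horth (n + c) (σ a + 1)
        (by have := (σ a).2; omega) (X ^ (σ a : ℕ))
        (by rw [degree_X_pow]; exact_mod_cast Nat.lt_succ_self _)
      simpa using h
    · simp
    · simp
  rw [hblocks, det_fromBlocks_zero₁₂, det_permute, det_transpose,
    det_map_X_pow_mul L _ (fun i => hdeg i) (fun i => hmonic i)]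

open Matrix Polynomial in
theorem integral_gammaWeight_mul_sq_det_vandermonde {n m : ℕ} {P : ℕ → ℝ[X]}
    (hmonic : ∀ k, (P k).Monic) (hdeg : ∀ k, (P k).natDegree = k)
    (horth : ∀ j k, j ≠ k → gammaMoment (P j * P k) = 0) (r : Fin m → ℝ) :
    (∫ x : Fin n → ℝ, (∏ j, (x j ^ 2 * Real.exp (-x j) * ∏ i, (r i - x j))) *
        (vandermonde x).det ^ 2 ∂(Measure.pi fun _ => volume.restrict (Set.Ioi 0))) *
        (vandermonde r).det =
      (∏ i ∈ range n, ((i + 1).factorial : ℝ) * (i + 2).factorial) *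
        (of fun i j : Fin m => (P (n + i)).eval (r j)).det := by
  let A : Equiv.Perm (Fin n) → Fin n → ℝ → Fin n ⊕ Fin m → ℝ := fun σ j t c =>
    t ^ 2 * Real.exp (-t) * (X ^ (σ j : ℕ) * P (finSumFinEquiv c)).eval t
  let B : Fin m → Fin n ⊕ Fin m → ℝ := fun i c => (P (finSumFinEquiv c)).eval (r i)
  have hrow := fun σ : Equiv.Perm (Fin n) => integral_det_sum_elim
    (volume.restrict (Set.Ioi 0)) (A σ) B fun j c => integrable_gammaWeight_mul_eval _
  have hexpand : ∀ x : Fin n → ℝ,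
      ((∏ j, (x j ^ 2 * Real.exp (-x j) * ∏ i, (r i - x j))) * (vandermonde x).det ^ 2) *
        (vandermonde r).det =
      ∑ σ : Equiv.Perm (Fin n), ((σ.sign : ℤ) : ℝ) *
        (of (Sum.elim (fun j => A σ j (x j)) B)).det := by
    intro x
    have hdet : ∀ σ : Equiv.Perm (Fin n), (of (Sum.elim (fun j => A σ j (x j)) B)).det =
        (∏ j, x j ^ 2 * Real.exp (-x j)) * (∏ j, x j ^ (σ j : ℕ)) *
          ((vandermonde x).det * (vandermonde r).det * ∏ j, ∏ i, (r i - x j)) := by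
      intro σ
      rw [← det_sum_elim_eval hmonic hdeg, ← prod_mul_distrib]
      have h := det_mul_column
        (Sum.elim (fun j => x j ^ 2 * Real.exp (-x j) * x j ^ (σ j : ℕ)) 1)
        (of (Sum.elim (fun j c => (P (finSumFinEquiv c)).eval (x j)) B))
      rw [Fintype.prod_sum_type] at h
      simp only [Sum.elim_inl, Sum.elim_inr, Pi.one_apply, prod_const_one, mul_one] at h
      rw [← h]
      congr 1
      ext (a | a) c
      · simp [A, mul_assoc]
      · simp
    have hv : (vandermonde x).det =
        ∑ σ : Equiv.Perm (Fin n), ((σ.sign : ℤ) : ℝ) * ∏ j, x j ^ (σ j : ℕ) := by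
      rw [← det_transpose, det_apply']
      rfl
    simp_rw [hdet]
    calc _ = (∏ j, x j ^ 2 * Real.exp (-x j)) * (vandermonde x).det *
          ((vandermonde x).det * (vandermonde r).det * ∏ j, ∏ i, (r i - x j)) := by
          rw [prod_mul_distrib]; ring
      _ = _ := by
          conv_lhs => rw [mul_comm (∏ j, x j ^ 2 * Real.exp (-x j)), hv, mul_assoc, sum_mul]
          rw [← hv]
          refine sum_congr rfl fun σ _ => ?_
          ring
  rw [← integral_mul_const]
  simp_rw [hexpand]
  rw [integral_finsetSum _ fun σ _ => (hrow σ).1.const_mul _]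
  have hterm : ∀ σ : Equiv.Perm (Fin n),
      ∫ x : Fin n → ℝ, ((σ.sign : ℤ) : ℝ) * (of (Sum.elim (fun j => A σ j (x j)) B)).det
        ∂(Measure.pi fun _ => volume.restrict (Set.Ioi 0)) =
      (∏ i ∈ range n, (i.factorial : ℝ) * (i + 2).factorial) *
        (of fun i j : Fin m => (P (n + i)).eval (r j)).det := by
    intro σ
    have hL := det_sum_elim_map gammaMoment hmonic hdeg horth r σ
    simp_rw [gammaMoment_X_pow] at hL
    rw [det_factorial_add_two] at hL
    have hsign : ((σ.sign : ℤ) : ℝ) * ((σ.sign : ℤ) : ℝ) = 1 := by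
      rcases Int.units_eq_one_or σ.sign with h | h <;> simp [h]
    rw [integral_const_mul, (hrow σ).2]
    refine (congrArg _ hL).trans ?_
    rw [mul_assoc, ← mul_assoc, hsign, one_mul]
  simp_rw [hterm, sum_const, card_univ, Fintype.card_perm, Fintype.card_fin, nsmul_eq_mul]
  rw [← mul_assoc]
  congr 1
  rw [← prod_range_add_one_eq_factorial, Nat.cast_prod, ← prod_mul_distrib]
  refine prod_congr rfl fun i _ => ?_
  rw [Nat.factorial_succ i]
  push_cast
  ring

/-- Mehta's orthogonal polynomial evaluation: for monic polynomials `P_k` of degree `k`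
orthogonal w.r.t. the weight `x² e^{-x}` on `[0,∞)` and distinct nodes `r₁,...,r_{α+1}`,
`∫_{(0,∞)^n} ∏_j x_j² e^{-x_j} ∏_i (r_i - x_j) Δ_n²(x) dx
  = ∏_{i=0}^{n-1}(i+1)!(i+2)! · det[P_{n+i-1}(r_j)] / Δ_{α+1}(r)`. -/
theorem stmt_11 (n α : ℕ) (hn : 1 ≤ n) (P : ℕ → Polynomial ℝ)
    (hmonic : ∀ k, (P k).Monic) (hdeg : ∀ k, (P k).natDegree = k)
    (horth : ∀ j k, j ≠ k →
      ∫ x in Set.Ioi (0 : ℝ), x ^ 2 * Real.exp (-x) * (P j).eval x * (P k).eval x = 0)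
    (r : Fin (α + 1) → ℝ) (hr : Function.Injective r) :
    ∫ x in {x : Fin n → ℝ | ∀ i, 0 < x i},
        (∏ j, ((x j) ^ 2 * Real.exp (-(x j)) * ∏ i, (r i - x j))) *
          (∏ p ∈ Finset.univ.filter (fun p : Fin n × Fin n => p.1 < p.2),
            (x p.2 - x p.1)) ^ 2 =
      (∏ i ∈ Finset.range n, ((i + 1).factorial : ℝ) * ((i + 2).factorial : ℝ)) *
        Matrix.det (Matrix.of fun i j : Fin (α + 1) => (P (n + i)).eval (r j)) /
          ∏ p ∈ Finset.univ.filter (fun p : Fin (α + 1) × Fin (α + 1) => p.1 < p.2),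
            (r p.2 - r p.1) := by
  have hset : {x : Fin n → ℝ | ∀ i, 0 < x i} = Set.univ.pi fun _ => Set.Ioi 0 := by
    ext x
    simp
  have horth' : ∀ j k, j ≠ k → gammaMoment (P j * P k) = 0 := fun j k hjk => by
    simpa only [gammaMoment_apply, Polynomial.eval_mul, mul_assoc] using horth j k hjk
  simp only [prod_filter_lt_eq_det_vandermonde]
  rw [hset, volume_pi, Measure.restrict_pi_pi,
    eq_div_iff (Matrix.det_vandermonde_ne_zero_iff.mpr hr)]
  exact integral_gammaWeight_mul_sq_det_vandermonde hmonic hdeg horth' r
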